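/- arXiv:1605.00124 — 7 statements merged into one kernel-verified Lean document; each statement's English description precedes it below -/
import Mathlib

section
/- For every positive integer V and every nonnegative integer w, the quantity R(V,w) = V + 1 + w + ⌈(V+1+w)/(2V)⌉·V is the least positive integer t satisfying V + 1 + w + ⌈t/(3V)⌉·V = t; that is, R(V,w) itself satisfies this equation, and every positive integer t satisfying the equation is at least R(V,w). -/
/-- `R V w = V + 1 + w + ⌈(V+1+w)/(2V)⌉·V`, the worst-case response time of a
computation segment of length `V+1` with one-shot interference `w` and periodic
interference of cost `V` every `3V` time units. -/
def R (V w : ℕ) : ℤ := (V : ℤ) + 1 + w + ⌈((V : ℚ) + 1 + (w : ℚ)) / (2 * V)⌉ * V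

theorem stmt0 (V w : ℕ) (hV : 0 < V) :
    (0 < R V w ∧
      (V : ℤ) + 1 + (w : ℤ) + ⌈((R V w : ℚ)) / (3 * V)⌉ * V = R V w) ∧
    ∀ t : ℤ, 0 < t →
      (V : ℤ) + 1 + (w : ℤ) + ⌈((t : ℚ)) / (3 * V)⌉ * V = t → R V w ≤ t := by
  have hVq : (0 : ℚ) < V := by exact_mod_cast hV
  obtain ⟨q, hq⟩ : ∃ q, ⌈((V : ℚ) + 1 + (w : ℚ)) / (2 * V)⌉ = q := ⟨_, rfl⟩
  have hR : R V w = (V : ℤ) + 1 + w + q * V := by rw [R, hq]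
  refine ⟨⟨?_, ?_⟩, fun t _ ht => ?_⟩
  · have hq0 : 0 ≤ q := hq ▸ Int.ceil_nonneg (by positivity)
    rw [hR]
    positivity
  · have hceil : ⌈((R V w : ℚ)) / (3 * V)⌉ = q := by
      rw [Int.ceil_eq_iff, lt_div_iff₀ (by positivity), div_le_iff₀ (by positivity)] at hq ⊢
      rw [hR]
      push_cast
      constructor <;> linarith [hq.1, hq.2]
    rw [hceil, hR]
  · obtain ⟨k, hk⟩ : ∃ k, ⌈(t : ℚ) / (3 * V)⌉ = k := ⟨_, rfl⟩
    rw [hk] at ht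
    have hle := hk ▸ Int.le_ceil ((t : ℚ) / (3 * V))
    rw [div_le_iff₀ (by positivity), ← ht] at hle
    push_cast at hle
    have hqk : q ≤ k := by
      rw [← hq, Int.ceil_le, div_le_iff₀ (by positivity)]
      linarith
    rw [hR, ← ht]
    gcongr
end

section
/- Let V be a positive integer and let a, b be nonnegative integers with 0 ≤ a ≤ V−1 and b > 2V. Then R(V,a) + R(V,b) ≤ R(V,V) + R(V, a + b − V). -/
theorem stmt3 (V a b : ℕ) (hV : 0 < V) (ha : a ≤ V - 1) (hb : 2 * V < b) :
    R V a + R V b ≤ R V V + R V (a + b - V) := by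
  have hVq : (0 : ℚ) < V := by exact_mod_cast hV
  have hcast : ((a + b - V : ℕ) : ℤ) = a + b - V := by omega
  have hcastq : ((a + b - V : ℕ) : ℚ) = a + b - V := by exact_mod_cast congrArg (Int.cast : ℤ → ℚ) hcast
  have haq : (a : ℚ) + 1 ≤ V := by exact_mod_cast (by omega : a + 1 ≤ V)
  have ceil_a : ⌈((V : ℚ) + 1 + a) / (2 * V)⌉ ≤ 1 := by
    rw [Int.ceil_le, div_le_iff₀ (by positivity)]
    push_cast
    linarith
  have ceil_V : 1 < ⌈((V : ℚ) + 1 + V) / (2 * V)⌉ := by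
    rw [Int.lt_ceil, lt_div_iff₀ (by positivity)]
    push_cast
    linarith
  have ceil_b : ⌈((V : ℚ) + 1 + b) / (2 * V)⌉ ≤
      ⌈((V : ℚ) + 1 + (a + b - V : ℕ)) / (2 * V)⌉ + 1 := by
    rw [← Int.ceil_add_one]
    apply Int.ceil_le_ceil
    rw [hcastq, div_add_one (by positivity)]
    gcongr ?_ / _
    linarith [(Nat.cast_nonneg a : (0 : ℚ) ≤ a)]
  have ceil_sum : ⌈((V : ℚ) + 1 + a) / (2 * V)⌉ + ⌈((V : ℚ) + 1 + b) / (2 * V)⌉ ≤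
      ⌈((V : ℚ) + 1 + V) / (2 * V)⌉ + ⌈((V : ℚ) + 1 + (a + b - V : ℕ)) / (2 * V)⌉ := by
    linarith
  have := mul_le_mul_of_nonneg_right ceil_sum (Int.natCast_nonneg V)
  unfold R
  linarith
end

section
/- Let M and V be positive integers and let w_1, …, w_M be nonnegative integers with ∑_{j=1}^{M} w_j = M·V. If there exists an index j with w_j ≠ V, then ∑_{j=1}^{M} R(V,w_j) ≤ M·(4V+1) − V. -/
theorem two_mul_mul_ceil_le {V : ℕ} (hV : 0 < V) (w : ℕ) :
    2 * (V : ℤ) * ⌈((V : ℚ) + 1 + (w : ℚ)) / (2 * V)⌉ ≤ 3 * V + w := by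
  have hV' : (0 : ℚ) < 2 * V := by positivity
  have h := Int.ceil_lt_add_one (((V : ℚ) + 1 + (w : ℚ)) / (2 * V))
  rw [← sub_lt_iff_lt_add, lt_div_iff₀ hV'] at h
  have h' : (⌈((V : ℚ) + 1 + (w : ℚ)) / (2 * V)⌉ - 1) * (2 * (V : ℤ)) < V + 1 + w := by
    exact_mod_cast h
  linarith

theorem ceil_le_one_of_lt {V w : ℕ} (hw : w < V) :
    ⌈((V : ℚ) + 1 + (w : ℚ)) / (2 * V)⌉ ≤ 1 := by
  have hV : 0 < V := by omega
  have hV' : (0 : ℚ) < 2 * V := by positivity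
  have hw' : (w : ℚ) + 1 ≤ V := by exact_mod_cast hw
  rw [Int.ceil_le, Int.cast_one, div_le_one hV']
  linarith

theorem stmt6 (M V : ℕ) (hM : 0 < M) (hV : 0 < V) (w : Fin M → ℕ)
    (hsum : ∑ j, w j = M * V) (hex : ∃ j, w j ≠ V) :
    ∑ j, R V (w j) ≤ (M : ℤ) * (4 * V + 1) - V := by
  have hVpos : (0 : ℤ) < V := by exact_mod_cast hV
  have hsum' : ∑ j, (w j : ℤ) = M * V := by exact_mod_cast hsum
  obtain ⟨k, hk⟩ : ∃ k, w k < V := by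
    by_contra! h
    obtain ⟨j, hj⟩ := hex
    have hlt : ∑ _j : Fin M, V < ∑ j, w j :=
      Finset.sum_lt_sum (fun i _ => h i) ⟨j, Finset.mem_univ j, lt_of_le_of_ne (h j) hj.symm⟩
    simp [hsum] at hlt
  have hlt : ∑ j, 2 * (V : ℤ) * ⌈((V : ℚ) + 1 + (w j : ℚ)) / (2 * V)⌉
      < ∑ j, (3 * (V : ℤ) + w j) := by
    refine Finset.sum_lt_sum (fun j _ => two_mul_mul_ceil_le hV (w j)) ⟨k, Finset.mem_univ k, ?_⟩
    have := ceil_le_one_of_lt hk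
    nlinarith
  rw [← Finset.mul_sum, Finset.sum_add_distrib, hsum'] at hlt
  simp only [Finset.sum_const, Finset.card_univ, Fintype.card_fin, nsmul_eq_mul] at hlt
  simp only [R, Finset.sum_add_distrib, ← Finset.sum_mul, hsum', Finset.sum_const,
    Finset.card_univ, Fintype.card_fin, nsmul_eq_mul]
  have hceil : ∑ j, ⌈((V : ℚ) + 1 + (w j : ℚ)) / (2 * V)⌉ < 2 * (M : ℤ) := by
    refine lt_of_mul_lt_mul_left (a := 2 * (V : ℤ)) ?_ (by positivity)
    linarith
  nlinarith
end

section
/- Let M and V be positive integers and let w_1, …, w_M be nonnegative integers with ∑_{j=1}^{M} w_j = M·V. Then ∑_{j=1}^{M} R(V,w_j) > M·(4V+1) − V if and only if w_j = V for every j = 1, …, M. -/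
theorem two_mul_ceil_sub_one_le {V : ℕ} (hV : 0 < V) (w : ℕ) :
    2 * (V : ℤ) * (⌈((V : ℚ) + 1 + (w : ℚ)) / (2 * V)⌉ - 1) ≤ V + w := by
  have hV' : (0 : ℚ) < 2 * V := by positivity
  have h := Int.ceil_lt_add_one (((V : ℚ) + 1 + (w : ℚ)) / (2 * V))
  rw [← sub_lt_iff_lt_add, lt_div_iff₀ hV'] at h
  have h' : (⌈((V : ℚ) + 1 + (w : ℚ)) / (2 * V)⌉ - 1) * (2 * (V : ℤ)) < V + 1 + w := by
    exact_mod_cast h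
  linarith [Int.lt_iff_add_one_le.mp h']

theorem ceil_two_mul_add_one_div {V : ℕ} (hV : 0 < V) :
    ⌈((V : ℚ) + 1 + (V : ℚ)) / (2 * V)⌉ = 2 := by
  have hV' : (0 : ℚ) < 2 * V := by positivity
  have hV1 : (1 : ℚ) ≤ V := by exact_mod_cast hV
  rw [Int.ceil_eq_iff, lt_div_iff₀ hV', div_le_iff₀ hV']
  constructor <;> push_cast <;> linarith

theorem sum_R_eq {M V : ℕ} {w : Fin M → ℕ} (hsum : ∑ j, w j = M * V) :
    ∑ j, R V (w j) =
      M * (2 * V + 1) + (∑ j, ⌈((V : ℚ) + 1 + (w j : ℚ)) / (2 * V)⌉) * V := by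
  have hs : ∑ j, (w j : ℤ) = M * V := by exact_mod_cast hsum
  simp only [R, Finset.sum_add_distrib, ← Finset.sum_mul, hs, Finset.sum_const,
    Finset.card_univ, Fintype.card_fin, nsmul_eq_mul]
  ring

theorem stmt7 (M V : ℕ) (hM : 0 < M) (hV : 0 < V) (w : Fin M → ℕ)
    (hsum : ∑ j, w j = M * V) :
    ((M : ℤ) * (4 * V + 1) - V < ∑ j, R V (w j)) ↔ (∀ j, w j = V) := by
  have hV' : (0 : ℤ) < V := by exact_mod_cast hV
  have hs : ∑ j, (w j : ℤ) = M * V := by exact_mod_cast hsum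
  rw [sum_R_eq hsum]
  constructor
  · intro h
    have hle := fun j => two_mul_ceil_sub_one_le hV (w j)
    generalize hc : (fun j => ⌈((V : ℚ) + 1 + (w j : ℚ)) / (2 * V)⌉) = c at h
    replace hle : ∀ j, 2 * (V : ℤ) * (c j - 1) ≤ V + w j := by
      subst hc; exact hle
    have hS : 2 * (M : ℤ) ≤ ∑ j, c j := by
      have : (2 * (M : ℤ) - 1) * V < (∑ j, c j) * V := by linarith
      have := lt_of_mul_lt_mul_right this hV'.le
      omega
    have hsl : ∑ j, 2 * (V : ℤ) * (c j - 1) = 2 * V * (∑ j, c j - M) := by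
      simp [← Finset.mul_sum, Finset.sum_sub_distrib]
    have hsr : ∑ j, ((V : ℤ) + w j) = 2 * V * M := by
      simp only [Finset.sum_add_distrib, hs, Finset.sum_const, Finset.card_univ,
        Fintype.card_fin, nsmul_eq_mul]
      ring
    have heq : ∑ j, 2 * (V : ℤ) * (c j - 1) = ∑ j, ((V : ℤ) + w j) := by
      refine le_antisymm (Finset.sum_le_sum fun j _ => hle j) ?_
      rw [hsl, hsr]
      gcongr
      linarith
    rw [Finset.sum_eq_sum_iff_of_le fun j _ => hle j] at heq
    have hge : ∀ j, V ≤ w j := by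
      intro j
      have hj := heq j (Finset.mem_univ j)
      have hw : (0 : ℤ) ≤ w j := by positivity
      have h2 : 2 ≤ c j := by
        by_contra! hlt
        nlinarith
      have : (V : ℤ) ≤ w j := by nlinarith
      exact_mod_cast this
    have hconst : ∑ _j : Fin M, V = ∑ j, w j := by simp [hsum]
    rw [Finset.sum_eq_sum_iff_of_le fun j _ => hge j] at hconst
    exact fun j => (hconst j (Finset.mem_univ j)).symm
  · intro h
    simp only [h, ceil_two_mul_add_one_div hV, Finset.sum_const, Finset.card_univ,
      Fintype.card_fin, nsmul_eq_mul]
    linarith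
end

section
/- Let q and x be positive integers and let ε be a real number with 0 < ε < 1/q. Then t₀ = 8qx is the least positive real number t satisfying x·(1−ε) + ⌈t/2⌉ + ⌈t/(4q)⌉·q + ⌈t/(8q)⌉·(2q−1+ε) = t; that is, t₀ satisfies this equation and every positive real t satisfying the equation is at least t₀. -/
theorem stmt9 (q x : ℕ) (hq : 0 < q) (hx : 0 < x) (ε : ℝ) (h1 : 0 < ε)
    (h2 : ε < 1 / q) :
    ((x : ℝ) * (1 - ε) + (⌈(8 * q * x : ℝ) / 2⌉ : ℝ)
        + (⌈(8 * q * x : ℝ) / (4 * q)⌉ : ℝ) * q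
        + (⌈(8 * q * x : ℝ) / (8 * q)⌉ : ℝ) * (2 * q - 1 + ε) = 8 * q * x) ∧
    ∀ t : ℝ, 0 < t →
      ((x : ℝ) * (1 - ε) + (⌈t / 2⌉ : ℝ) + (⌈t / (4 * q)⌉ : ℝ) * q
          + (⌈t / (8 * q)⌉ : ℝ) * (2 * q - 1 + ε) = t) →
      (8 * q * x : ℝ) ≤ t := by
  have hq1 : (1 : ℝ) ≤ q := by exact_mod_cast hq
  have hq0 : (q : ℝ) ≠ 0 := by positivity
  have hε : ε < 1 := h2.trans_le (div_le_one_of_le₀ hq1 (by positivity))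
  constructor
  · have e1 : (8 * q * x : ℝ) / 2 = ((4 * q * x : ℕ) : ℝ) := by push_cast; ring
    have e2 : (8 * q * x : ℝ) / (4 * q) = ((2 * x : ℕ) : ℝ) := by
      push_cast; field_simp; norm_num
    have e3 : (8 * q * x : ℝ) / (8 * q) = (x : ℝ) := by field_simp
    rw [e1, e2, e3, Int.ceil_natCast, Int.ceil_natCast, Int.ceil_natCast]
    push_cast
    ring
  · intro t _ h
    have c1 := Int.le_ceil (t / 2)
    have c2 := mul_le_mul_of_nonneg_right (Int.le_ceil (t / (4 * q))) (by positivity : (0 : ℝ) ≤ q)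
    have c3 := mul_le_mul_of_nonneg_right (Int.le_ceil (t / (8 * q)))
      (by linarith : (0 : ℝ) ≤ 2 * q - 1 + ε)
    have e : t / 2 + t / (4 * q) * q + t / (8 * q) * (2 * q - 1 + ε)
        = t - t / (8 * q) * (1 - ε) := by
      field_simp
      ring
    have key : (x : ℝ) * (1 - ε) ≤ t / (8 * q) * (1 - ε) := by linarith
    have hxt := le_of_mul_le_mul_right key (by linarith)
    rw [le_div_iff₀ (by positivity)] at hxt
    linarith
end

section
/- Let q be a positive integer and ε a real number with 0 < ε < 1/q. Define R := 8q² + 6q + 1 + q·ε, offsets (O₁, O₂, O₃) := (0, ε/4, ε/2), integers (N₁, N₂, N₃) := (4q²+3q+1, 2q+2, q+1), periods (T₁, T₂, T₃) := (2, 4q, 8q), and execution times (C₁, C₂, C₃) := (1, q, 2q−1+ε). Then: (i) R = (1−ε) + N₁·C₁ + N₂·C₂ + N₃·C₃; (ii) for each i ∈ {1,2,3}, 0 ≤ N_i ≤ ⌈(R − O_i)/T_i⌉; and (iii) for each i ∈ {1,2,3}, setting rel_i := O_i + (N_i − 1)·T_i, one has R > rel_i + ∑_{ℓ=1}^{3}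 max(0, ⌊(O_ℓ + N_ℓ·T_ℓ − rel_i)/T_ℓ⌋·C_ℓ). -/
theorem floor_div_eq_of_mul_le_of_lt {K : Type*} [Field K] [LinearOrder K]
    [IsStrictOrderedRing K] [FloorRing K] {a t : K} {z : ℤ} (ht : 0 < t) (hle : (z : K) * t ≤ a)
    (hlt : a < ((z : K) + 1) * t) : ⌊a / t⌋ = z :=
  Int.floor_eq_iff.2 ⟨(le_div_iff₀ ht).2 hle, (div_lt_iff₀ ht).2 hlt⟩

theorem le_ceil_div_of_sub_one_mul_lt {K : Type*} [Field K] [LinearOrder K]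
    [IsStrictOrderedRing K] [FloorRing K] {a t : K} {z : ℤ} (ht : 0 < t)
    (h : ((z : K) - 1) * t < a) : z ≤ ⌈a / t⌉ := by
  rw [← Int.sub_one_lt_iff, Int.lt_ceil, lt_div_iff₀ ht]
  push_cast
  exact h

theorem stmt10 (q : ℕ) (hq : 0 < q) (ε : ℝ) (h1 : 0 < ε) (h2 : ε < 1 / q) :
    let R : ℝ := 8 * q ^ 2 + 6 * q + 1 + q * ε
    let O : Fin 3 → ℝ := ![0, ε / 4, ε / 2]
    let N : Fin 3 → ℤ := ![4 * q ^ 2 + 3 * q + 1, 2 * q + 2, q + 1]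
    let T : Fin 3 → ℝ := ![2, 4 * q, 8 * q]
    let C : Fin 3 → ℝ := ![1, q, 2 * q - 1 + ε]
    let rel : Fin 3 → ℝ := fun i => O i + ((N i : ℝ) - 1) * T i
    (R = (1 - ε) + ∑ i, (N i : ℝ) * C i) ∧
    (∀ i, 0 ≤ N i ∧ N i ≤ ⌈(R - O i) / T i⌉) ∧
    (∀ i,
      rel i + ∑ ℓ, max 0 ((⌊(O ℓ + (N ℓ : ℝ) * T ℓ - rel i) / T ℓ⌋ : ℝ) * C ℓ)
        < R) := by
  intro R O N T C rel
  have hq1 : (1 : ℝ) ≤ q := by exact_mod_cast hq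
  have hq0 : (0 : ℝ) < q := by linarith
  have hqε : 0 < q * ε := by positivity
  have hε1 : ε < 1 := h2.trans_le ((div_le_one hq0).2 hq1)
  have floor_eq (i l : Fin 3) (z : ℤ) (ht : 0 < T l)
      (hle : (z : ℝ) * T l ≤ O l + (N l : ℝ) * T l - rel i)
      (hlt : O l + (N l : ℝ) * T l - rel i < ((z : ℝ) + 1) * T l) :
      ⌊(O l + (N l : ℝ) * T l - rel i) / T l⌋ = z :=
    floor_div_eq_of_mul_le_of_lt ht hle hlt
  have hT (l : Fin 3) : 0 < T l := by
    fin_cases l <;> simp [T, hq]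
  refine ⟨?_, fun i => ⟨?_, le_ceil_div_of_sub_one_mul_lt (hT i) ?_⟩, fun i => ?_⟩
  · simp [R, N, C, Fin.sum_univ_three]
    ring
  · fin_cases i <;> simp [N] <;> positivity
  · fin_cases i <;> simp [N, T, R, O] <;> nlinarith
  · rw [Fin.sum_univ_three]
    fin_cases i
    · have e0 := floor_eq 0 0 1 (hT 0) (by simp [O, N, T, rel]; nlinarith)
        (by simp [O, N, T, rel]; nlinarith)
      have e1 := floor_eq 0 1 0 (hT 1) (by simp [O, N, T, rel]; nlinarith)
        (by simp [O, N, T, rel]; nlinarith)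
      have e2 := floor_eq 0 2 0 (hT 2) (by simp [O, N, T, rel]; nlinarith)
        (by simp [O, N, T, rel]; nlinarith)
      simp only [Fin.zero_eta, e0, e1, e2]
      simp [R, O, N, T, C, rel]
      nlinarith
    · have e0 := floor_eq 1 0 q (hT 0) (by simp [O, N, T, rel]; nlinarith)
        (by simp [O, N, T, rel]; nlinarith)
      have e1 := floor_eq 1 1 1 (hT 1) (by simp [O, N, T, rel]; nlinarith)
        (by simp [O, N, T, rel]; nlinarith)
      have e2 := floor_eq 1 2 0 (hT 2) (by simp [O, N, T, rel]; nlinarith)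
        (by simp [O, N, T, rel]; nlinarith)
      simp only [Fin.mk_one, e0, e1, e2]
      simp [R, O, N, T, C, rel]
      nlinarith
    · have e0 := floor_eq 2 0 (3 * q) (hT 0) (by simp [O, N, T, rel]; nlinarith)
        (by simp [O, N, T, rel]; nlinarith)
      have e1 := floor_eq 2 1 1 (hT 1) (by simp [O, N, T, rel]; nlinarith)
        (by simp [O, N, T, rel]; nlinarith)
      have e2 := floor_eq 2 2 1 (hT 2) (by simp [O, N, T, rel]; nlinarith)
        (by simp [O, N, T, rel]; nlinarith)
      have hC : 0 ≤ 2 * (q : ℝ) - 1 + ε := by linarith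
      simp only [Fin.reduceFinMk, e0, e1, e2]
      simp [R, O, N, T, C, rel, max_eq_right hC]
      nlinarith
end

section
/- Let M and V be positive integers and let v_2, …, v_{3M+1} be nonnegative integers with ∑_{j=2}^{3M+1} v_j = M·V. Define the rational number D := 3MV/2 if M is even and D := 3MV/2 + V/2 if M is odd. Then for every index i with 2 ≤ i ≤ 3M+1, V·⌈D/(3V)⌉ + ∑_{j=2}^{i} v_j ≤ D. -/
theorem stmt15 (M V : ℕ) (hM : 0 < M) (hV : 0 < V) (v : ℕ → ℕ)
    (hsum : ∑ j ∈ Finset.Icc 2 (3 * M + 1), v j = M * V)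
    (D : ℚ)
    (hD : D = if Even M then 3 * (M : ℚ) * V / 2 else 3 * (M : ℚ) * V / 2 + V / 2) :
    ∀ i, 2 ≤ i → i ≤ 3 * M + 1 →
      (V : ℚ) * (⌈D / (3 * V)⌉ : ℚ) + ∑ j ∈ Finset.Icc 2 i, (v j : ℚ) ≤ D := by
  intro i _ hi
  have hV' : (0 : ℚ) < V := by exact_mod_cast hV
  have hle : ∑ j ∈ Finset.Icc 2 i, (v j : ℚ) ≤ M * V := by
    have h : ∑ j ∈ Finset.Icc 2 i, v j ≤ M * V :=
      hsum ▸ Finset.sum_le_sum_of_subset (Finset.Icc_subset_Icc_right hi)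
    exact_mod_cast h
  rcases Nat.even_or_odd' M with ⟨k, rfl | rfl⟩
  · rw [if_pos (even_two_mul k)] at hD
    have hquot : D / (3 * V) = ((k : ℤ) : ℚ) := by
      rw [hD]; push_cast; field_simp
    rw [hquot, Int.ceil_intCast, hD]
    push_cast at hle ⊢
    linarith
  · rw [if_neg (Nat.not_even_two_mul_add_one k)] at hD
    have hquot : D / (3 * V) = k + 2 / 3 := by
      rw [hD]; push_cast; field_simp; ring
    have hceil : ⌈D / (3 * V)⌉ = (k : ℤ) + 1 := by
      rw [hquot, Int.ceil_eq_iff]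
      push_cast
      constructor <;> linarith
    rw [hceil, hD]
    push_cast at hle ⊢
    linarith
end
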